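/- Let H be a finite connected simple graph with no false twins and at least 7 vertices, and let B be a biclique of H such that exactly 2 bicliques of H distinct from B have nonempty intersection with B (i.e., the vertex of KB(H) corresponding to B has degree 2). Then exactly one of the following holds: (1) B = {v, w} is an edge with N[v] = N[w], the vertices v and w have a unique common neighbor x, and the set N(x) ∖ {v, w} is an independent set of H; or (2) B = {a, b, c} induces a path a–b–c and moreover N(a) = {b} and N(b) = {a, c}. -/

import Mathlib

open SimpleGraph

variable {V : Type}

/-- `B1`, `B2` are the two (nonempty) parts of an induced complete bipartite subgraph:
they are disjoint, each part is independent, and all edges between the parts are present. -/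
def IsCBP (H : SimpleGraph V) (B1 B2 : Set V) : Prop :=
  B1.Nonempty ∧ B2.Nonempty ∧ Disjoint B1 B2 ∧
    (∀ a ∈ B1, ∀ b ∈ B1, ¬H.Adj a b) ∧
    (∀ a ∈ B2, ∀ b ∈ B2, ¬H.Adj a b) ∧
    (∀ a ∈ B1, ∀ b ∈ B2, H.Adj a b)

/-- A set of vertices inducing a complete bipartite subgraph `K_{m,n}`, `m, n ≥ 1`. -/
def IsCompleteBipartiteSet (H : SimpleGraph V) (S : Set V) : Prop :=
  ∃ B1 B2 : Set V, IsCBP H B1 B2 ∧ B1 ∪ B2 = S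

/-- A biclique: a maximal set of vertices inducing a complete bipartite subgraph. -/
def IsBiclique (H : SimpleGraph V) (S : Set V) : Prop :=
  IsCompleteBipartiteSet H S ∧
    ∀ T : Set V, IsCompleteBipartiteSet H T → S ⊆ T → S = T

/-- The biclique graph `KB(H)`: the intersection graph of the bicliques of `H`. -/
def KB (H : SimpleGraph V) : SimpleGraph {S : Set V // IsBiclique H S} :=
  SimpleGraph.fromRel fun A B => (A.1 ∩ B.1).Nonempty


/-- First-order form of being (contained in) a complete bipartite vertex set. -/
def CB {V : Type} (H : SimpleGraph V) (S : Set V) : Prop :=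
  ∀ x ∈ S, ∀ y ∈ S, ∀ z ∈ S, H.Adj x y → (H.Adj z x ↔ ¬ H.Adj z y)

theorem cbs_iff {V : Type} (H : SimpleGraph V) (S : Set V) :
    IsCompleteBipartiteSet H S ↔ (∃ x ∈ S, ∃ y ∈ S, H.Adj x y) ∧ CB H S := by
  constructor
  · rintro ⟨B1, B2, ⟨⟨a, ha⟩, ⟨b, hb⟩, hd, h1, h2, h3⟩, rfl⟩
    refine ⟨⟨a, Or.inl ha, b, Or.inr hb, h3 a ha b hb⟩, ?_⟩
    intro x hx y hy z hz hxy
    have hs := fun a b => H.adj_comm a b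
    rcases hx with hx | hx <;> rcases hy with hy | hy <;> rcases hz with hz | hz <;> grind
  · rintro ⟨⟨x, hx, y, hy, hxy⟩, h⟩
    have hs := fun a b => H.adj_comm a b
    refine ⟨{z | z ∈ S ∧ H.Adj z y}, {z | z ∈ S ∧ H.Adj z x}, ⟨⟨x, hx, hxy⟩,
      ⟨y, hy, hxy.symm⟩, ?_, ?_, ?_, ?_⟩, ?_⟩
    · rw [Set.disjoint_left]
      rintro z ⟨hz, h1⟩ ⟨_, h2⟩
      exact ((h x hx y hy z hz hxy).1 h2) h1
    · rintro a ⟨ha, ha'⟩ b ⟨hb, hb'⟩ hab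
      have := h a ha b hb y hy hab
      grind
    · rintro a ⟨ha, ha'⟩ b ⟨hb, hb'⟩ hab
      have := h a ha b hb x hx hab
      grind
    · rintro a ⟨ha, ha'⟩ b ⟨hb, hb'⟩
      have h1 := h x hx y hy b hb hxy
      have h2 := h a ha y hy b hb ha'
      grind
    · ext z
      simp only [Set.mem_union, Set.mem_ofPred_eq]
      have := fun hz => h x hx y hy z hz hxy
      grind

theorem exists_biclique {V : Type} [Fintype V] (H : SimpleGraph V) (T : Set V)
    (hT : IsCompleteBipartiteSet H T) : ∃ S, IsBiclique H S ∧ T ⊆ S := by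
  obtain ⟨S, hTS, hS⟩ := (Set.toFinite {S : Set V | IsCompleteBipartiteSet H S}).exists_le_maximal hT
  exact ⟨S, ⟨hS.1, fun U hU hSU => Set.Subset.antisymm hSU (hS.2 hU hSU)⟩, hTS⟩

theorem card_le_six {V : Type} [Fintype V] (p0 p1 p2 p3 p4 p5 : V → Prop)
    (h : ∀ s, p0 s ∨ p1 s ∨ p2 s ∨ p3 s ∨ p4 s ∨ p5 s)
    (h0 : ∀ s t, p0 s → p0 t → s = t) (h1 : ∀ s t, p1 s → p1 t → s = t)
    (h2 : ∀ s t, p2 s → p2 t → s = t) (h3 : ∀ s t, p3 s → p3 t → s = t)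
    (h4 : ∀ s t, p4 s → p4 t → s = t) (h5 : ∀ s t, p5 s → p5 t → s = t) :
    Fintype.card V ≤ 6 := by
  have : ∀ s, ∃ i : Fin 6, (i = 0 → p0 s) ∧ (i = 1 → p1 s) ∧ (i = 2 → p2 s) ∧ (i = 3 → p3 s) ∧
      (i = 4 → p4 s) ∧ (i = 5 → p5 s) := by
    intro s
    rcases h s with h | h | h | h | h | h
    · exact ⟨0, by simp [h]⟩
    · exact ⟨1, by simp [h]⟩
    · exact ⟨2, by simp [h]⟩
    · exact ⟨3, by simp [h]⟩
    · exact ⟨4, by simp [h]⟩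
    · exact ⟨5, by simp [h]⟩
  choose f hf using this
  have hinj : Function.Injective f := by
    intro s t hst
    have a := hf s
    have b := hf t
    rw [← hst] at b
    generalize f s = i at a b
    fin_cases i <;> simp at a b
    · exact h0 _ _ a b
    · exact h1 _ _ a b
    · exact h2 _ _ a b
    · exact h3 _ _ a b
    · exact h4 _ _ a b
    · exact h5 _ _ a b
  simpa using Fintype.card_le_of_injective f hinj

theorem closed_univ {V : Type} (H : SimpleGraph V) (hconn : H.Connected) (p : V → Prop)
    (a : V) (ha : p a) (hcl : ∀ x y, p x → H.Adj x y → p y) (s : V) : p s := by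
  obtain ⟨w⟩ := hconn.preconnected a s
  induction w with
  | nil => exact ha
  | cons h _ ih => exact ih (hcl _ _ ha h)

/-- The situation of the lemma in a convenient form. -/
structure Sit {V : Type} (H : SimpleGraph V) (B1 B2 P Q : Set V) : Prop where
  conn : H.Connected
  tw : ∀ v w, (∀ x, H.Adj v x ↔ H.Adj w x) → v = w
  ne1 : B1.Nonempty
  ne2 : B2.Nonempty
  dj : ∀ x ∈ B1, x ∉ B2
  i1 : ∀ a ∈ B1, ∀ b ∈ B1, ¬H.Adj a b
  i2 : ∀ a ∈ B2, ∀ b ∈ B2, ¬H.Adj a b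
  c : ∀ a ∈ B1, ∀ b ∈ B2, H.Adj a b
  mx : ∀ z, z ∉ B1 → z ∉ B2 → ¬ ((∀ a ∈ B1, H.Adj z a) ∧ (∀ b ∈ B2, ¬ H.Adj z b))
  my : ∀ z, z ∉ B1 → z ∉ B2 → ¬ ((∀ a ∈ B1, ¬ H.Adj z a) ∧ (∀ b ∈ B2, H.Adj z b))
  cP : CB H P
  cQ : CB H Q
  nP : ¬ (B1 ∪ B2 ⊆ P)
  nQ : ¬ (B1 ∪ B2 ⊆ Q)
  cov : ∀ T : Set V, CB H T → ∀ x y z, x ∈ T → y ∈ T → H.Adj x y → x ∈ B1 ∪ B2 → z ∈ T →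
    z ∉ B1 ∪ B2 → T ⊆ P ∨ T ⊆ Q

theorem Sit.swapB {V : Type} {H : SimpleGraph V} {B1 B2 P Q : Set V} (h : Sit H B1 B2 P Q) :
    Sit H B2 B1 P Q where
  conn := h.conn
  tw := h.tw
  ne1 := h.ne2
  ne2 := h.ne1
  dj := fun x hx hx' => h.dj x hx' hx
  i1 := h.i2
  i2 := h.i1
  c := fun a ha b hb => (h.c b hb a ha).symm
  mx := fun z h1 h2 h3 => h.my z h2 h1 h3.symm
  my := fun z h1 h2 h3 => h.mx z h2 h1 h3.symm
  cP := h.cP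
  cQ := h.cQ
  nP := by rw [Set.union_comm]; exact h.nP
  nQ := by rw [Set.union_comm]; exact h.nQ
  cov := by rw [Set.union_comm]; exact h.cov

theorem Sit.swapP {V : Type} {H : SimpleGraph V} {B1 B2 P Q : Set V} (h : Sit H B1 B2 P Q) :
    Sit H B1 B2 Q P where
  conn := h.conn
  tw := h.tw
  ne1 := h.ne1
  ne2 := h.ne2
  dj := h.dj
  i1 := h.i1
  i2 := h.i2
  c := h.c
  mx := h.mx
  my := h.my
  cP := h.cQ
  cQ := h.cP
  nP := h.nQ
  nQ := h.nP
  cov := fun T a x y z b c d e f g => (h.cov T a x y z b c d e f g).symm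

/-- Edges leaving the biclique. -/
theorem Sit.edge {V : Type} {H : SimpleGraph V} {B1 B2 P Q : Set V} (h : Sit H B1 B2 P Q)
    (v t : V) (hv : v ∈ B1 ∨ v ∈ B2) (ht1 : t ∉ B1) (ht2 : t ∉ B2) (hvt : H.Adj v t) :
    (v ∈ P ∧ t ∈ P) ∨ (v ∈ Q ∧ t ∈ Q) := by
  have hs := fun a b => H.adj_comm a b
  have := h.cov {v, t} (by
    intro x hx y hy z hz
    simp only [Set.mem_insert_iff, Set.mem_singleton_iff] at hx hy hz
    have := H.irrefl (v := v)
    have := H.irrefl (v := t)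
    grind) v t t (by simp) (by simp) hvt hv (by simp) (by simp [ht1, ht2])
  grind

/-- Induced paths `v - z - s` starting in the biclique, with `z` outside. -/
theorem Sit.path {V : Type} {H : SimpleGraph V} {B1 B2 P Q : Set V} (h : Sit H B1 B2 P Q)
    (v z s : V) (hv : v ∈ B1 ∨ v ∈ B2) (ht1 : z ∉ B1) (ht2 : z ∉ B2) (hvz : H.Adj v z)
    (hzs : H.Adj z s) (hvs : ¬ H.Adj v s) :
    (v ∈ P ∧ z ∈ P ∧ s ∈ P) ∨ (v ∈ Q ∧ z ∈ Q ∧ s ∈ Q) := by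
  have hs := fun a b => H.adj_comm a b
  have := h.cov {v, z, s} (by
    intro x hx y hy z hz
    simp only [Set.mem_insert_iff, Set.mem_singleton_iff] at hx hy hz
    have := fun v => H.irrefl (v := v)
    grind) v z z (by simp) (by simp) hvz hv (by simp) (by simp [ht1, ht2])
  grind

/-- Induced paths `t - x - y` with only `t` outside the biclique. -/
theorem Sit.path2 {V : Type} {H : SimpleGraph V} {B1 B2 P Q : Set V} (h : Sit H B1 B2 P Q)
    (t x x' : V) (hx : x ∈ B1 ∨ x ∈ B2) (ht1 : t ∉ B1) (ht2 : t ∉ B2) (htx : H.Adj t x)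
    (hxx : H.Adj x x') (htx' : ¬ H.Adj t x') :
    (t ∈ P ∧ x ∈ P ∧ x' ∈ P) ∨ (t ∈ Q ∧ x ∈ Q ∧ x' ∈ Q) := by
  have hs := fun a b => H.adj_comm a b
  have := h.cov {t, x, x'} (by
    intro x hx y hy z hz
    simp only [Set.mem_insert_iff, Set.mem_singleton_iff] at hx hy hz
    have := fun v => H.irrefl (v := v)
    grind) x t t (by simp) (by simp) htx.symm hx (by simp) (by simp [ht1, ht2])
  grind

/-- The two alternatives. -/
def Alt1 {V : Type} (H : SimpleGraph V) (B : Set V) : Prop :=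
  ∃ v w x : V, v ≠ w ∧ B = {v, w} ∧ H.Adj v w ∧
        insert v (H.neighborSet v) = insert w (H.neighborSet w) ∧
        H.neighborSet v ∩ H.neighborSet w = {x} ∧
        ∀ a ∈ H.neighborSet x \ {v, w}, ∀ b ∈ H.neighborSet x \ {v, w}, ¬H.Adj a b

def Alt2 {V : Type} (H : SimpleGraph V) (B : Set V) : Prop :=
  ∃ a b c : V, a ≠ b ∧ b ≠ c ∧ a ≠ c ∧ B = {a, b, c} ∧
        H.Adj a b ∧ H.Adj b c ∧ ¬H.Adj a c ∧
        H.neighborSet a = {b} ∧ H.neighborSet b = {a, c}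

set_option maxHeartbeats 1000000 in
/-- Case A: a vertex outside `B` sees both sides. -/
theorem caseA_aux {V : Type} [Fintype V] {H : SimpleGraph V} {B1 B2 P Q : Set V}
    (h : Sit H B1 B2 P Q) (hcard : 7 ≤ Fintype.card V) (z v y : V) (hz1 : z ∉ B1) (hz2 : z ∉ B2)
    (hv : v ∈ B1) (hy : y ∈ B2) (hzv : H.Adj z v) (hzy : H.Adj z y)
    (hT1 : ∀ x, (x = z ∨ (x ∈ B1 ∧ H.Adj z x) ∨ (x ∈ B2 ∧ ¬ H.Adj z x)) → x ∈ P)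
    (hT2 : ∀ x, (x = z ∨ (x ∈ B2 ∧ H.Adj z x) ∨ (x ∈ B1 ∧ ¬ H.Adj z x)) → x ∈ Q) :
    Alt1 H (B1 ∪ B2) := by
  have hs := fun a b => H.adj_comm a b
  have hir := fun v => H.irrefl (v := v)
  have dj := h.dj
  have i1 := h.i1
  have i2 := h.i2
  have c := h.c
  have hvy := c v hv y hy
  have zP : z ∈ P := hT1 z (by simp)
  have zQ : z ∈ Q := hT2 z (by simp)
  have vP : v ∈ P := hT1 v (by simp [hv, hzv])
  have yQ : y ∈ Q := hT2 y (by simp [hy, hzy])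
  have P1 : ∀ u ∈ B1, H.Adj z u → u ∈ P ∧ u ∉ Q := by
    intro u hu hzu
    refine ⟨hT1 u (by simp [hu, hzu]), fun huQ => ?_⟩
    have := h.cQ z zQ y yQ u huQ hzy
    grind
  have P2 : ∀ u ∈ B2, H.Adj z u → u ∈ Q ∧ u ∉ P := by
    intro u hu hzu
    refine ⟨hT2 u (by simp [hu, hzu]), fun huQ => ?_⟩
    have := h.cP z zP v vP u huQ hzv
    grind
  have P3 : ∀ u ∈ B1, ¬ H.Adj z u → u ∈ Q ∧ u ∉ P := by
    intro u hu hzu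
    refine ⟨hT2 u (by simp [hu, hzu]), fun huQ => ?_⟩
    have := h.cP z zP v vP u huQ hzv
    grind
  have P4 : ∀ u ∈ B2, ¬ H.Adj z u → u ∈ P ∧ u ∉ Q := by
    intro u hu hzu
    refine ⟨hT1 u (by simp [hu, hzu]), fun huQ => ?_⟩
    have := h.cQ z zQ y yQ u huQ hzy
    grind
  clear hT1 hT2
  have half : ∀ u ∈ B1, ∀ u' ∈ B1, (H.Adj z u ↔ H.Adj z u') → ∀ x, H.Adj u x → H.Adj u' x := by
    intro u hu u' hu' hzz x hux
    by_cases hx1 : x ∈ B1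
    · grind
    by_cases hx2 : x ∈ B2
    · grind
    have a := h.edge u x (Or.inl hu) hx1 hx2 hux
    by_cases hzu : H.Adj z u
    · have b := P1 u hu hzu
      have b' := P1 u' hu' (hzz.1 hzu)
      have := h.cP u b.1 x (by grind) u' b'.1 hux
      grind
    · have b := P3 u hu hzu
      have b' := P3 u' hu' (by grind)
      have := h.cQ u b.1 x (by grind) u' b'.1 hux
      grind
  have half2 : ∀ u ∈ B2, ∀ u' ∈ B2, (H.Adj z u ↔ H.Adj z u') → ∀ x, H.Adj u x → H.Adj u' x := by
    intro u hu u' hu' hzz x hux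
    by_cases hx1 : x ∈ B1
    · grind
    by_cases hx2 : x ∈ B2
    · grind
    have a := h.edge u x (Or.inr hu) hx1 hx2 hux
    by_cases hzu : H.Adj z u
    · have b := P2 u hu hzu
      have b' := P2 u' hu' (hzz.1 hzu)
      have := h.cQ u b.1 x (by grind) u' b'.1 hux
      grind
    · have b := P4 u hu hzu
      have b' := P4 u' hu' (by grind)
      have := h.cP u b.1 x (by grind) u' b'.1 hux
      grind
  have E1 : ∀ u ∈ B1, ∀ u' ∈ B1, (H.Adj z u ↔ H.Adj z u') → u = u' := fun u hu u' hu' e =>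
    h.tw _ _ fun x => ⟨half u hu u' hu' e x, half u' hu' u hu e.symm x⟩
  have E2 : ∀ u ∈ B2, ∀ u' ∈ B2, (H.Adj z u ↔ H.Adj z u') → u = u' := fun u hu u' hu' e =>
    h.tw _ _ fun x => ⟨half2 u hu u' hu' e x, half2 u' hu' u hu e.symm x⟩
  clear half half2
  obtain ⟨_, vQ⟩ := P1 v hv hzv
  obtain ⟨_, yP⟩ := P2 y hy hzy
  have U : ∀ u ∈ B1, u ≠ v → ¬ H.Adj z u ∧ u ∈ Q ∧ u ∉ P := by grind
  have W : ∀ w ∈ B2, w ≠ y → ¬ H.Adj z w ∧ w ∈ P ∧ w ∉ Q := by grind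
  have U1 : ∀ u ∈ B1, ∀ u' ∈ B1, u ≠ v → u' ≠ v → u = u' := by grind
  have W1 : ∀ u ∈ B2, ∀ u' ∈ B2, u ≠ y → u' ≠ y → u = u' := by grind
  clear E1 E2 P1 P2 P3 P4
  have F1 : ∀ t, t ∉ B1 → t ∉ B2 → H.Adj t v → H.Adj t y := by
    intro t h1 h2 h3
    by_contra h4
    have := h.path2 t v y (Or.inl hv) h1 h2 h3 hvy h4
    grind
  have F2 : ∀ t, t ∉ B1 → t ∉ B2 → H.Adj t y → H.Adj t v := by
    intro t h1 h2 h3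
    by_contra h4
    have := h.path2 t y v (Or.inr hy) h1 h2 h3 hvy.symm h4
    grind
  have F3 : ∀ t, t ∉ B1 → t ∉ B2 → H.Adj t v → t ∈ P ∧ t ∈ Q := by
    intro t h1 h2 h3
    have a := h.edge v t (Or.inl hv) h1 h2 h3.symm
    have b := h.edge y t (Or.inr hy) h1 h2 (F1 t h1 h2 h3).symm
    grind
  have F4 : ∀ t, t ∉ B1 → t ∉ B2 → H.Adj t v → ∀ u ∈ B1, u ≠ v → ¬ H.Adj t u := by
    intro t h1 h2 h3 u hu huv htu
    have a := U u hu huv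
    have b := F3 t h1 h2 h3
    have e := c u hu y hy
    have := h.cQ t b.2 u a.2.1 y yQ htu
    have := F1 t h1 h2 h3
    grind
  have F5 : ∀ t, t ∉ B1 → t ∉ B2 → H.Adj t v → ∀ u ∈ B2, u ≠ y → ¬ H.Adj t u := by
    intro t h1 h2 h3 u hu huv htu
    have a := W u hu huv
    have b := F3 t h1 h2 h3
    have e := c v hv u hu
    have := h.cP t b.1 u a.2.1 v vP htu
    grind
  have F6 : ∀ t, t ∉ B1 → t ∉ B2 → ¬ H.Adj t v → ∀ u ∈ B1, H.Adj t u → ∀ w ∈ B2, w ≠ y →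
      H.Adj t w := by
    intro t h1 h2 h3 u hu htu w hw hwy
    by_contra h4
    have := h.path2 t u w (Or.inl hu) h1 h2 htu (c u hu w hw) h4
    grind
  have F7 : ∀ t, t ∉ B1 → t ∉ B2 → ¬ H.Adj t v → ∀ w ∈ B2, H.Adj t w → ∀ u ∈ B1, u ≠ v →
      H.Adj t u := by
    intro t h1 h2 h3 u hu htu w hw hwy
    by_contra h4
    have := h.path2 t u w (Or.inr hu) h1 h2 htu (c w hw u hu).symm h4
    grind
  have F8 : ∀ t t', t ∉ B1 → t ∉ B2 → t' ∉ B1 → t' ∉ B2 → H.Adj t v → H.Adj t' v →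
      ¬ H.Adj t t' := by
    intro t t' h1 h2 h1' h2' h3 h3' h4
    have := h.cP t (F3 t h1 h2 h3).1 t' (F3 t' h1' h2' h3').1 v vP h4
    grind
  have F9 : ∀ t s, t ∉ B1 → t ∉ B2 → H.Adj t v → H.Adj t s → ¬ H.Adj s v → ¬ H.Adj s y →
      s ∈ P ∧ s ∈ Q := by
    intro t s h1 h2 h3 h4 h5 h6
    have a := h.path v t s (Or.inl hv) h1 h2 h3.symm h4 (by grind)
    have b := h.path y t s (Or.inr hy) h1 h2 (F1 t h1 h2 h3).symm h4 (by grind)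
    grind
  by_cases hUW : (∀ u ∈ B1, u = v) ∧ (∀ w ∈ B2, w = y)
  · obtain ⟨hU, hW⟩ := hUW
    have tz : ∀ t t' x, t ∉ B1 → t ∉ B2 → H.Adj t v → t' ∉ B1 → t' ∉ B2 → H.Adj t' v →
        H.Adj t x → H.Adj t' x := by
      intro t t' x h1 h2 h3 h1' h2' h3' htx
      by_cases hx1 : x ∈ B1
      · grind
      by_cases hx2 : x ∈ B2
      · grind
      have hxv : ¬ H.Adj x v := by grind
      have hxy : ¬ H.Adj x y := by grind
      have a := F9 t x h1 h2 h3 htx hxv hxy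
      have := h.cP t (F3 t h1 h2 h3).1 x a.1 t' (F3 t' h1' h2' h3').1 htx
      grind
    have tz' : ∀ t, t ∉ B1 → t ∉ B2 → H.Adj t v → t = z := fun t h1 h2 h3 =>
      h.tw _ _ fun x => ⟨tz t z x h1 h2 h3 hz1 hz2 hzv, tz z t x hz1 hz2 hzv h1 h2 h3⟩
    refine ⟨v, y, z, hvy.ne, ?_, hvy, ?_, ?_, ?_⟩
    · ext x
      simp only [Set.mem_union, Set.mem_insert_iff, Set.mem_singleton_iff]
      grind
    · ext x
      simp only [Set.mem_insert_iff, SimpleGraph.mem_neighborSet]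
      grind
    · ext x
      simp only [Set.mem_inter_iff, Set.mem_singleton_iff, SimpleGraph.mem_neighborSet]
      grind
    · rintro a ⟨ha, ha'⟩ b ⟨hb, hb'⟩ hab
      simp only [Set.mem_insert_iff, Set.mem_singleton_iff, SimpleGraph.mem_neighborSet] at ha ha' hb hb'
      have a1 : a ∈ P := (F9 z a hz1 hz2 hzv ha (by grind) (by grind)).1
      have b1 : b ∈ P := (F9 z b hz1 hz2 hzv hb (by grind) (by grind)).1
      have := h.cP a a1 b b1 z zP hab
      grind
  exfalso
  obtain ⟨Zc, hZc⟩ : ∃ Zc : V → Prop, ∀ t, Zc t ↔ (t ∉ B1 ∧ t ∉ B2 ∧ H.Adj t v) :=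
    ⟨_, fun _ => Iff.rfl⟩
  obtain ⟨Tc, hTc⟩ : ∃ Tc : V → Prop, ∀ t, Tc t ↔ (t ∉ B1 ∧ t ∉ B2 ∧ ¬ H.Adj t v ∧
      (∀ u ∈ B1, u ≠ v → H.Adj t u) ∧ (∀ u ∈ B2, u ≠ y → H.Adj t u)) :=
    ⟨_, fun _ => Iff.rfl⟩
  have G1 : ∀ t, t ∉ B1 → t ∉ B2 → ∀ x, (x ∈ B1 ∨ x ∈ B2) → H.Adj t x → Zc t ∨ Tc t := by
    intro t h1 h2 x hx htx
    by_cases h3 : H.Adj t v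
    · exact Or.inl ((hZc t).2 ⟨h1, h2, h3⟩)
    · right
      rw [hTc]
      refine ⟨h1, h2, h3, ?_, ?_⟩
      · intro u hu huv
        rcases hx with hx | hx
        · have := U1 u hu x hx huv (by grind)
          grind
        · exact F7 t h1 h2 h3 x hx htx u hu huv
      · intro u hu huv
        rcases hx with hx | hx
        · exact F6 t h1 h2 h3 x hx htx u hu huv
        · have := W1 u hu x hx huv (by grind)
          grind
  have hUW' : (∃ u ∈ B1, u ≠ v) ∨ (∃ w ∈ B2, w ≠ y) := by grind
  have TQ : ∀ u ∈ B1, u ≠ v → ∀ t, Tc t → t ∈ Q ∧ H.Adj t u := by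
    intro u hu huv t ht
    rw [hTc] at ht
    have := h.edge u t (Or.inl hu) ht.1 ht.2.1 (by grind)
    grind
  have TP : ∀ w ∈ B2, w ≠ y → ∀ t, Tc t → t ∈ P ∧ H.Adj t w := by
    intro u hu huv t ht
    rw [hTc] at ht
    have := h.edge u t (Or.inr hu) ht.1 ht.2.1 (by grind)
    grind
  have TT : ∀ t t', Tc t → Tc t' → ¬ H.Adj t t' := by
    intro t t' ht ht' htt
    rcases hUW' with ⟨u, hu, huv⟩ | ⟨w, hw, hwy⟩
    · have a := TQ u hu huv t ht
      have b := TQ u hu huv t' ht'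
      have := h.cQ t a.1 t' b.1 u (U u hu huv).2.1 htt
      grind
    · have a := TP w hw hwy t ht
      have b := TP w hw hwy t' ht'
      have := h.cP t a.1 t' b.1 w (W w hw hwy).2.1 htt
      grind
  have ZT : ∀ t t', Zc t → Tc t' → H.Adj t t' := by
    intro t t' ht ht'
    rw [hZc] at ht
    have f := F3 t ht.1 ht.2.1 ht.2.2
    rcases hUW' with ⟨u, hu, huv⟩ | ⟨w, hw, hwy⟩
    · have b := TQ u hu huv t' ht'
      have := h.cQ t' b.1 u (U u hu huv).2.1 t f.2 b.2
      have := F4 t ht.1 ht.2.1 ht.2.2 u hu huv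
      grind
    · have b := TP w hw hwy t' ht'
      have := h.cP t' b.1 w (W w hw hwy).2.1 t f.1 b.2
      have := F5 t ht.1 ht.2.1 ht.2.2 w hw hwy
      grind
  have Znb : ∀ t s, Zc t → H.Adj t s → s ∉ B1 → s ∉ B2 → Tc s := by
    intro t s ht hts h1 h2
    rw [hZc] at ht
    have f := F3 t ht.1 ht.2.1 ht.2.2
    have hsv : ¬ H.Adj s v := by grind
    have hsy : ¬ H.Adj s y := by grind
    have g := F9 t s ht.1 ht.2.1 ht.2.2 hts hsv hsy
    rcases hUW' with ⟨u, hu, huv⟩ | ⟨w, hw, hwy⟩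
    · have := h.cQ t f.2 s g.2 u (U u hu huv).2.1 hts
      have := F4 t ht.1 ht.2.1 ht.2.2 u hu huv
      have := G1 s h1 h2 u (Or.inl hu) (by grind)
      grind
    · have := h.cP t f.1 s g.1 w (W w hw hwy).2.1 hts
      have := F5 t ht.1 ht.2.1 ht.2.2 w hw hwy
      have := G1 s h1 h2 w (Or.inr hw) (by grind)
      grind
  have Tnb : ∀ t s, Tc t → H.Adj t s → s ∉ B1 → s ∉ B2 → Zc s := by
    intro t s ht hts h1 h2
    by_contra hZ
    have nT : ¬ Tc s := fun hT => TT t s ht hT hts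
    have nB := fun x hx hsx => (G1 s h1 h2 x hx hsx).elim hZ nT
    have ht' := (hTc t).1 ht
    have hty : ¬ H.Adj t y := by grind
    rcases hUW' with ⟨u, hu, huv⟩ | ⟨w, hw, hwy⟩
    · have b := TQ u hu huv t ht
      have a := U u hu huv
      have g := h.path u t s (Or.inl hu) ht'.1 ht'.2.1 b.2.symm hts
        (fun hh => nB u (Or.inl hu) hh.symm)
      have := h.cQ t b.1 s (by grind) y yQ hts
      exact nB y (Or.inr hy) (by grind)
    · have b := TP w hw hwy t ht
      have a := W w hw hwy
      have g := h.path w t s (Or.inr hw) ht'.1 ht'.2.1 b.2.symm hts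
        (fun hh => nB w (Or.inr hw) hh.symm)
      have := h.cP t b.1 s (by grind) v vP hts
      exact nB v (Or.inl hv) (by grind)
  have all : ∀ s, s ∈ B1 ∨ s ∈ B2 ∨ Zc s ∨ Tc s := by
    refine closed_univ H h.conn (fun s => s ∈ B1 ∨ s ∈ B2 ∨ Zc s ∨ Tc s) v (Or.inl hv) ?_
    intro x s hx hxs
    by_cases h1 : s ∈ B1
    · exact Or.inl h1
    by_cases h2 : s ∈ B2
    · exact Or.inr (Or.inl h2)
    rcases hx with hx | hx | hx | hx
    · have := G1 s h1 h2 x (Or.inl hx) hxs.symm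
      grind
    · have := G1 s h1 h2 x (Or.inr hx) hxs.symm
      grind
    · have := Znb x s hx hxs h1 h2
      grind
    · have := Tnb x s hx hxs h1 h2
      grind
  have twZ : ∀ t t' x, Zc t → Zc t' → H.Adj t x → H.Adj t' x := by
    intro t t' x ht ht' htx
    by_cases hx1 : x ∈ B1
    · grind
    by_cases hx2 : x ∈ B2
    · grind
    exact ZT t' x ht' (Znb t x ht htx hx1 hx2)
  have twT : ∀ t t' x, Tc t → Tc t' → H.Adj t x → H.Adj t' x := by
    intro t t' x ht ht' htx
    by_cases hx1 : x ∈ B1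
    · grind
    by_cases hx2 : x ∈ B2
    · have := (hTc t).1 ht
      have := (hTc t').1 ht'
      grind
    exact (ZT x t' (Tnb t x ht htx hx1 hx2) ht').symm
  have := card_le_six (fun s => s = v) (fun s => s = y) (fun s => s ∈ B1 ∧ s ≠ v)
    (fun s => s ∈ B2 ∧ s ≠ y) Zc Tc (by grind) (by grind) (by grind) (by grind) (by grind)
    (fun t t' ht ht' => h.tw _ _ fun x => ⟨twZ t t' x ht ht', twZ t' t x ht' ht⟩)
    (fun t t' ht ht' => h.tw _ _ fun x => ⟨twT t t' x ht ht', twT t' t x ht' ht⟩)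
  omega

theorem caseA {V : Type} [Fintype V] {H : SimpleGraph V} {B1 B2 P Q : Set V}
    (h : Sit H B1 B2 P Q) (hcard : 7 ≤ Fintype.card V) (z v y : V) (hz1 : z ∉ B1) (hz2 : z ∉ B2)
    (hv : v ∈ B1) (hy : y ∈ B2) (hzv : H.Adj z v) (hzy : H.Adj z y) :
    Alt1 H (B1 ∪ B2) := by
  have hs := fun a b => H.adj_comm a b
  have hir := fun v => H.irrefl (v := v)
  have dj := h.dj
  have i1 := h.i1
  have i2 := h.i2
  have c := h.c
  have hvy := c v hv y hy
  have t1 := h.cov {x | x = z ∨ (x ∈ B1 ∧ H.Adj z x) ∨ (x ∈ B2 ∧ ¬ H.Adj z x)} (by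
    intro a ha b hb d hd
    simp only [Set.mem_ofPred_eq] at ha hb hd
    grind) v z z (by simp [hv, hzv]) (by simp) hzv.symm (by simp [hv]) (by simp)
      (by simp [hz1, hz2])
  have t2 := h.cov {x | x = z ∨ (x ∈ B2 ∧ H.Adj z x) ∨ (x ∈ B1 ∧ ¬ H.Adj z x)} (by
    intro a ha b hb d hd
    simp only [Set.mem_ofPred_eq] at ha hb hd
    grind) y z z (by simp [hy, hzy]) (by simp) hzy.symm (by simp [hy]) (by simp)
      (by simp [hz1, hz2])
  have tri : ∀ S, CB H S → z ∈ S → v ∈ S → y ∈ S → False := by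
    intro S hS a b d
    have := hS z a v b y d hzv
    grind
  rcases t1 with t1 | t1 <;> rcases t2 with t2 | t2
  · exact (tri P h.cP (t1 (by simp)) (t1 (by simp [hv, hzv])) (t2 (by simp [hy, hzy]))).elim
  · exact caseA_aux h hcard z v y hz1 hz2 hv hy hzv hzy (fun x hx => t1 hx) (fun x hx => t2 hx)
  · exact caseA_aux h.swapP hcard z v y hz1 hz2 hv hy hzv hzy (fun x hx => t1 hx)
      (fun x hx => t2 hx)
  · exact (tri Q h.cQ (t1 (by simp)) (t1 (by simp [hv, hzv])) (t2 (by simp [hy, hzy]))).elim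

/-- In Case B no outside vertex sees both sides. -/
def OneSided {V : Type} (H : SimpleGraph V) (B1 B2 : Set V) : Prop :=
  ∀ z, z ∉ B1 → z ∉ B2 → ∀ a ∈ B1, ∀ b ∈ B2, H.Adj z a → ¬ H.Adj z b

/-- `S` contains `z`, all of `B2` and exactly the neighbours of `z` in `B1`. -/
def Dd {V : Type} (H : SimpleGraph V) (B1 B2 : Set V) (z : V) (S : Set V) : Prop :=
  z ∈ S ∧ (∀ b ∈ B2, b ∈ S) ∧ ∀ u ∈ B1, u ∈ S ↔ H.Adj z u

theorem caseB_D {V : Type} {H : SimpleGraph V} {B1 B2 P Q : Set V}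
    (h : Sit H B1 B2 P Q) (ho : OneSided H B1 B2) (z v : V) (hz1 : z ∉ B1) (hz2 : z ∉ B2)
    (hv : v ∈ B1) (hzv : H.Adj z v) : Dd H B1 B2 z P ∨ Dd H B1 B2 z Q := by
  have hs := fun a b => H.adj_comm a b
  have hir := fun v => H.irrefl (v := v)
  have dj := h.dj
  have i1 := h.i1
  have i2 := h.i2
  have c := h.c
  have nz : ∀ b ∈ B2, ¬ H.Adj z b := fun b hb => ho z hz1 hz2 v hv b hb hzv
  have t1 := h.cov {x | x = z ∨ x ∈ B2 ∨ (x ∈ B1 ∧ H.Adj z x)} (by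
    intro a ha b hb d hd
    simp only [Set.mem_ofPred_eq] at ha hb hd
    grind) v z z (by simp [hv, hzv]) (by simp) hzv.symm (by simp [hv]) (by simp)
      (by simp [hz1, hz2])
  obtain ⟨y, hy⟩ := h.ne2
  have key : ∀ S, CB H S → {x | x = z ∨ x ∈ B2 ∨ (x ∈ B1 ∧ H.Adj z x)} ⊆ S →
      Dd H B1 B2 z S := by
    intro S hS hT
    have zS : z ∈ S := hT (by simp)
    have bS : ∀ b ∈ B2, b ∈ S := fun b hb => hT (by simp [hb])
    refine ⟨zS, bS, fun u hu => ⟨fun huS => ?_, fun hzu => hT (by simp [hu, hzu])⟩⟩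
    have := hS u huS y (bS y hy) z zS (c u hu y hy)
    grind
  rcases t1 with t1 | t1
  · exact Or.inl (key P h.cP t1)
  · exact Or.inr (key Q h.cQ t1)

theorem caseB_noext {V : Type} {H : SimpleGraph V} {B1 B2 P Q : Set V}
    (h : Sit H B1 B2 P Q) (ho : OneSided H B1 B2)
    (hP : ∀ b ∈ B2, b ∈ P) (hQ : ∀ b ∈ B1, b ∈ Q)
    (K1 : ∀ z, z ∉ B1 → z ∉ B2 → ∀ v ∈ B1, H.Adj z v → z ∈ P ∧ ∀ u ∈ B1, u ∈ P ↔ H.Adj z u)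
    (t s v : V) (ht1 : t ∉ B1) (ht2 : t ∉ B2) (hs1 : s ∉ B1) (hs2 : s ∉ B2) (hv : v ∈ B1)
    (htv : H.Adj t v) (hts : H.Adj t s) : False := by
  have hs := fun a b => H.adj_comm a b
  have kt := K1 t ht1 ht2 v hv htv
  have ks := K1 s hs1 hs2
  have vP : v ∈ P := (kt.2 v hv).2 htv
  have nt : ∀ b ∈ B2, ¬ H.Adj t b := fun b hb => ho t ht1 ht2 v hv b hb htv
  by_cases hsv : H.Adj s v
  · have := h.cP t kt.1 s (ks v hv hsv).1 v vP hts
    grind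
  have ns : ∀ u ∈ B1, ¬ H.Adj s u := by
    intro u hu hsu
    have := (ks u hu hsu).2 v hv
    grind
  rcases h.path v t s (Or.inl hv) ht1 ht2 htv.symm hts (by grind) with g | g
  · apply h.my s hs1 hs2
    refine ⟨ns, fun b hb => ?_⟩
    have := h.cP t kt.1 s g.2.2 b (hP b hb) hts
    have := nt b hb
    grind
  · apply h.mx t ht1 ht2
    refine ⟨fun u hu => ?_, nt⟩
    have := h.cQ t g.2.1 s g.2.2 u (hQ u hu) hts
    have := ns u hu
    grind

set_option maxHeartbeats 2000000 in
theorem caseB_two_aux {V : Type} [Fintype V] {H : SimpleGraph V} {B1 B2 P Q : Set V}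
    (h : Sit H B1 B2 P Q) (hcard : 7 ≤ Fintype.card V) (ho : OneSided H B1 B2)
    (z1 z2 : V) (d1 : Dd H B1 B2 z1 P) (d2 : Dd H B2 B1 z2 Q) : False := by
  have hs := fun a b => H.adj_comm a b
  have ho' : OneSided H B2 B1 := fun z a b c d e f g i => ho z b a e f c d i g
  have dj := h.dj
  have i1 := h.i1
  have i2 := h.i2
  have c := h.c
  obtain ⟨-, hP, -⟩ := d1
  obtain ⟨-, hQ, -⟩ := d2
  have nP : ¬ ∀ b ∈ B1, b ∈ P := fun hh => h.nP fun x hx => hx.elim (hh x) (hP x)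
  have nQ : ¬ ∀ b ∈ B2, b ∈ Q := fun hh => h.nQ fun x hx => hx.elim (hQ x) (hh x)
  have K1 : ∀ z, z ∉ B1 → z ∉ B2 → ∀ v ∈ B1, H.Adj z v →
      z ∈ P ∧ ∀ u ∈ B1, u ∈ P ↔ H.Adj z u := by
    intro z h1 h2 v hv hzv
    rcases caseB_D h ho z v h1 h2 hv hzv with ⟨a, b, d⟩ | ⟨a, b, d⟩
    · exact ⟨a, d⟩
    · exact (nQ b).elim
  have K2 : ∀ z, z ∉ B2 → z ∉ B1 → ∀ v ∈ B2, H.Adj z v →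
      z ∈ Q ∧ ∀ u ∈ B2, u ∈ Q ↔ H.Adj z u := by
    intro z h1 h2 v hv hzv
    rcases caseB_D h.swapB ho' z v h1 h2 hv hzv with ⟨a, b, d⟩ | ⟨a, b, d⟩
    · exact (nP b).elim
    · exact ⟨a, d⟩
  have X1 := caseB_noext h ho hP hQ K1
  have X2 := caseB_noext h.swapB.swapP ho' hQ hP K2
  obtain ⟨v0, hv0⟩ := h.ne1
  have all : ∀ s, s ∈ B1 ∨ s ∈ B2 ∨ (s ∉ B1 ∧ s ∉ B2 ∧ ∃ v ∈ B1, H.Adj s v) ∨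
      (s ∉ B1 ∧ s ∉ B2 ∧ ∃ v ∈ B2, H.Adj s v) := by
    refine closed_univ H h.conn (fun s => s ∈ B1 ∨ s ∈ B2 ∨ (s ∉ B1 ∧ s ∉ B2 ∧ ∃ v ∈ B1, H.Adj s v) ∨
      (s ∉ B1 ∧ s ∉ B2 ∧ ∃ v ∈ B2, H.Adj s v)) v0 (Or.inl hv0) ?_
    intro x s hx hxs
    by_cases h1 : s ∈ B1
    · exact Or.inl h1
    by_cases h2 : s ∈ B2
    · exact Or.inr (Or.inl h2)
    rcases hx with hx | hx | ⟨x1, x2, v, hv, hxv⟩ | ⟨x1, x2, v, hv, hxv⟩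
    · exact Or.inr (Or.inr (Or.inl ⟨h1, h2, x, hx, hxs.symm⟩))
    · exact Or.inr (Or.inr (Or.inr ⟨h1, h2, x, hx, hxs.symm⟩))
    · exact (X1 x s v x1 x2 h1 h2 hv hxv hxs).elim
    · exact (X2 x s v x2 x1 h2 h1 hv hxv hxs).elim
  have T1 : ∀ u ∈ B1, ∀ u' ∈ B1, (u ∈ P ↔ u' ∈ P) → ∀ x, H.Adj u x → H.Adj u' x := by
    intro u hu u' hu' e x hux
    by_cases h1 : x ∈ B1
    · grind
    by_cases h2 : x ∈ B2
    · grind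
    have := (K1 x h1 h2 u hu hux.symm).2
    grind
  have T2 : ∀ u ∈ B2, ∀ u' ∈ B2, (u ∈ Q ↔ u' ∈ Q) → ∀ x, H.Adj u x → H.Adj u' x := by
    intro u hu u' hu' e x hux
    by_cases h1 : x ∈ B1
    · grind
    by_cases h2 : x ∈ B2
    · grind
    have := (K2 x h2 h1 u hu hux.symm).2
    grind
  have E1 : ∀ u ∈ B1, ∀ u' ∈ B1, (u ∈ P ↔ u' ∈ P) → u = u' := fun u hu u' hu' e =>
    h.tw _ _ fun x => ⟨T1 u hu u' hu' e x, T1 u' hu' u hu e.symm x⟩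
  have E2 : ∀ u ∈ B2, ∀ u' ∈ B2, (u ∈ Q ↔ u' ∈ Q) → u = u' := fun u hu u' hu' e =>
    h.tw _ _ fun x => ⟨T2 u hu u' hu' e x, T2 u' hu' u hu e.symm x⟩
  have T3 : ∀ t t' x, (t ∉ B1 ∧ t ∉ B2 ∧ ∃ v ∈ B1, H.Adj t v) →
      (t' ∉ B1 ∧ t' ∉ B2 ∧ ∃ v ∈ B1, H.Adj t' v) → H.Adj t x → H.Adj t' x := by
    rintro t t' x ⟨t1, t2, v, hv, htv⟩ ⟨t1', t2', v', hv', htv'⟩ htx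
    by_cases h1 : x ∈ B1
    · have a := (K1 t t1 t2 v hv htv).2 x h1
      have b := (K1 t' t1' t2' v' hv' htv').2 x h1
      exact b.1 (a.2 htx)
    by_cases h2 : x ∈ B2
    · exact (ho t t1 t2 v hv x h2 htv htx).elim
    exact (X1 t x v t1 t2 h1 h2 hv htv htx).elim
  have T4 : ∀ t t' x, (t ∉ B1 ∧ t ∉ B2 ∧ ∃ v ∈ B2, H.Adj t v) →
      (t' ∉ B1 ∧ t' ∉ B2 ∧ ∃ v ∈ B2, H.Adj t' v) → H.Adj t x → H.Adj t' x := by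
    rintro t t' x ⟨t1, t2, v, hv, htv⟩ ⟨t1', t2', v', hv', htv'⟩ htx
    by_cases h2 : x ∈ B2
    · have a := (K2 t t2 t1 v hv htv).2 x h2
      have b := (K2 t' t2' t1' v' hv' htv').2 x h2
      exact b.1 (a.2 htx)
    by_cases h1 : x ∈ B1
    · exact (ho t t1 t2 x h1 v hv htx htv).elim
    exact (X2 t x v t2 t1 h2 h1 hv htv htx).elim
  have := card_le_six (fun s => s ∈ B1 ∧ s ∈ P) (fun s => s ∈ B1 ∧ s ∉ P)
    (fun s => s ∈ B2 ∧ s ∈ Q) (fun s => s ∈ B2 ∧ s ∉ Q)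
    (fun s => s ∉ B1 ∧ s ∉ B2 ∧ ∃ v ∈ B1, H.Adj s v)
    (fun s => s ∉ B1 ∧ s ∉ B2 ∧ ∃ v ∈ B2, H.Adj s v)
    (by
      intro s
      by_cases hp : s ∈ P <;> by_cases hq : s ∈ Q <;> rcases all s with a | a | a | a <;>
        first
        | exact Or.inl ⟨a, hp⟩
        | exact Or.inr (Or.inl ⟨a, hp⟩)
        | exact Or.inr (Or.inr (Or.inl ⟨a, hq⟩))
        | exact Or.inr (Or.inr (Or.inr (Or.inl ⟨a, hq⟩)))
        | exact Or.inr (Or.inr (Or.inr (Or.inr (Or.inl a))))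
        | exact Or.inr (Or.inr (Or.inr (Or.inr (Or.inr a)))))
    (fun s t a b => E1 s a.1 t b.1 (by simp [a.2, b.2]))
    (fun s t a b => E1 s a.1 t b.1 (by simp [a.2, b.2]))
    (fun s t a b => E2 s a.1 t b.1 (by simp [a.2, b.2]))
    (fun s t a b => E2 s a.1 t b.1 (by simp [a.2, b.2]))
    (fun t t' ht ht' => h.tw _ _ fun x => ⟨T3 t t' x ht ht', T3 t' t x ht' ht⟩)
    (fun t t' ht ht' => h.tw _ _ fun x => ⟨T4 t t' x ht ht', T4 t' t x ht' ht⟩)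
  omega

theorem caseB_two {V : Type} [Fintype V] {H : SimpleGraph V} {B1 B2 P Q : Set V}
    (h : Sit H B1 B2 P Q) (hcard : 7 ≤ Fintype.card V) (ho : OneSided H B1 B2)
    (z1 v1 z2 v2 : V) (h11 : z1 ∉ B1) (h12 : z1 ∉ B2) (h21 : z2 ∉ B1) (h22 : z2 ∉ B2)
    (hv1 : v1 ∈ B1) (hv2 : v2 ∈ B2) (a1 : H.Adj z1 v1) (a2 : H.Adj z2 v2) : False := by
  have ho' : OneSided H B2 B1 := fun z a b c d e f g i => ho z b a e f c d i g
  rcases caseB_D h ho z1 v1 h11 h12 hv1 a1 with d1 | d1 <;>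
    rcases caseB_D h.swapB ho' z2 v2 h22 h21 hv2 a2 with d2 | d2
  · exact h.nP fun x hx => hx.elim (d2.2.1 x) (d1.2.1 x)
  · exact caseB_two_aux h hcard ho z1 z2 d1 d2
  · exact caseB_two_aux h.swapP hcard ho z1 z2 d1 d2
  · exact h.nQ fun x hx => hx.elim (d2.2.1 x) (d1.2.1 x)

theorem star_CB {V : Type} (H : SimpleGraph V) (w b z1 z2 : V) (e1 : H.Adj z1 w)
    (e2 : H.Adj z2 w) (e3 : H.Adj w b) (n1 : ¬ H.Adj z1 b) (n2 : ¬ H.Adj z2 b)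
    (e4 : ¬ H.Adj z1 z2) : CB H {w, b, z1, z2} := by
  have hs := fun a b => H.adj_comm a b
  have hir := fun v => H.irrefl (v := v)
  intro x hx y hy z hz
  simp only [Set.mem_insert_iff, Set.mem_singleton_iff] at hx hy hz
  rcases hx with rfl | rfl | rfl | rfl <;> rcases hy with rfl | rfl | rfl | rfl <;>
    rcases hz with rfl | rfl | rfl | rfl <;> grind

set_option maxHeartbeats 2000000 in
theorem caseB_one_aux {V : Type} [Fintype V] {H : SimpleGraph V} {B1 B2 P Q : Set V}
    (h : Sit H B1 B2 P Q) (hcard : 7 ≤ Fintype.card V) (ho : OneSided H B1 B2)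
    (hn : ∀ z, z ∉ B1 → z ∉ B2 → ∀ b ∈ B2, ¬ H.Adj z b) (b : V) (hb : ∀ x, x ∈ B2 ↔ x = b)
    (z1 z2 u0 : V) (h11 : z1 ∉ B1) (h12 : z1 ∉ B2) (h21 : z2 ∉ B1) (h22 : z2 ∉ B2)
    (hu0 : u0 ∈ B1) (a1 : H.Adj z1 u0) (a2 : ¬ H.Adj z2 u0)
    (d1 : Dd H B1 B2 z1 P) (d2 : Dd H B1 B2 z2 Q) : False := by
  have hs := fun a b => H.adj_comm a b
  have hir := fun v => H.irrefl (v := v)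
  have dj := h.dj
  have i1 := h.i1
  have c := h.c
  have hbB : b ∈ B2 := (hb b).2 rfl
  have bP : b ∈ P := d1.2.1 b hbB
  have bQ : b ∈ Q := d2.2.1 b hbB
  have uP : u0 ∈ P := (d1.2.2 u0 hu0).2 a1
  have uQ : u0 ∉ Q := fun hh => a2 ((d2.2.2 u0 hu0).1 hh)
  have step : ∀ t s v, t ∉ B1 → t ∉ B2 → s ∉ B1 → s ∉ B2 → v ∈ B1 → H.Adj t v → H.Adj t s →
      H.Adj s v := by
    intro t s v t1 t2 s1 s2 hv htv hts
    by_contra hsv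
    have n1 := hn t t1 t2 b hbB
    have n2 := hn s s1 s2 b hbB
    rcases h.path v t s (Or.inl hv) t1 t2 htv.symm hts (by grind) with g | g
    · have := h.cP t g.2.1 s g.2.2 b bP hts
      grind
    · have := h.cQ t g.2.1 s g.2.2 b bQ hts
      grind
  have no : ∀ t s v, t ∉ B1 → t ∉ B2 → s ∉ B1 → s ∉ B2 → v ∈ B1 → H.Adj t v → ¬ H.Adj t s := by
    intro t s v t1 t2 s1 s2 hv htv hts
    have hsv := step t s v t1 t2 s1 s2 hv htv hts
    have tr : H.Adj t u0 ↔ H.Adj s u0 :=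
      ⟨fun hh => step t s u0 t1 t2 s1 s2 hu0 hh hts,
       fun hh => step s t u0 s1 s2 t1 t2 hu0 hh hts.symm⟩
    have n1 := hn t t1 t2 b hbB
    have n2 := hn s s1 s2 b hbB
    rcases caseB_D h ho t v t1 t2 hv htv with d | d <;>
      rcases caseB_D h ho s v s1 s2 hv hsv with e | e
    · have := h.cP t d.1 s e.1 b bP hts
      grind
    · have := d.2.2 u0 hu0
      have := e.2.2 u0 hu0
      grind
    · have := d.2.2 u0 hu0
      have := e.2.2 u0 hu0
      grind
    · have := h.cQ t d.1 s e.1 b bQ hts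
      grind
  have all : ∀ s, s ∈ B1 ∨ s = b ∨ (s ∉ B1 ∧ s ∉ B2 ∧ ∃ v ∈ B1, H.Adj s v) := by
    refine closed_univ H h.conn
      (fun s => s ∈ B1 ∨ s = b ∨ (s ∉ B1 ∧ s ∉ B2 ∧ ∃ v ∈ B1, H.Adj s v)) u0 (Or.inl hu0) ?_
    intro x s hx hxs
    by_cases h1 : s ∈ B1
    · exact Or.inl h1
    by_cases h2 : s ∈ B2
    · exact Or.inr (Or.inl ((hb s).1 h2))
    rcases hx with hx | hx | ⟨x1, x2, v, hv, hxv⟩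
    · exact Or.inr (Or.inr ⟨h1, h2, x, hx, hxs.symm⟩)
    · exact (hn s h1 h2 x ((hb x).2 hx) hxs.symm).elim
    · exact (no x s v x1 x2 h1 h2 hv hxv hxs).elim
  have T1 : ∀ u ∈ B1, ∀ u' ∈ B1, (u ∈ P ↔ u' ∈ P) → (u ∈ Q ↔ u' ∈ Q) →
      ∀ x, H.Adj u x → H.Adj u' x := by
    intro u hu u' hu' e e' x hux
    by_cases h1 : x ∈ B1
    · grind
    by_cases h2 : x ∈ B2
    · grind
    rcases caseB_D h ho x u h1 h2 hu hux.symm with d | d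
    · have := d.2.2 u hu
      have := d.2.2 u' hu'
      grind
    · have := d.2.2 u hu
      have := d.2.2 u' hu'
      grind
  have E1 : ∀ u ∈ B1, ∀ u' ∈ B1, (u ∈ P ↔ u' ∈ P) → (u ∈ Q ↔ u' ∈ Q) → u = u' :=
    fun u hu u' hu' e e' =>
      h.tw _ _ fun x => ⟨T1 u hu u' hu' e e' x, T1 u' hu' u hu e.symm e'.symm x⟩
  have T2 : ∀ t t' x, (t ∉ B1 ∧ t ∉ B2 ∧ ∃ v ∈ B1, H.Adj t v) →
      (t' ∉ B1 ∧ t' ∉ B2 ∧ ∃ v ∈ B1, H.Adj t' v) → (∀ u ∈ B1, H.Adj t u ↔ H.Adj t' u) →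
      H.Adj t x → H.Adj t' x := by
    rintro t t' x ⟨t1, t2, v, hv, htv⟩ ⟨t1', t2', v', hv', htv'⟩ e htx
    by_cases h1 : x ∈ B1
    · exact (e x h1).1 htx
    by_cases h2 : x ∈ B2
    · exact (ho t t1 t2 v hv x h2 htv htx).elim
    exact (no t x v t1 t2 h1 h2 hv htv htx).elim
  have nest : (∀ u ∈ B1, u ∈ Q → u ∉ P) ∨ (∀ u ∈ B1, u ∈ Q → u ∈ P) := by
    by_contra! hh
    obtain ⟨⟨w, hw, wQ, wP⟩, ⟨x, hx, xQ, xP⟩⟩ := hh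
    have e1 := (d1.2.2 w hw).1 wP
    have e2 := (d2.2.2 w hw).1 wQ
    have n1 := hn z1 h11 h12 b hbB
    have n2 := hn z2 h21 h22 b hbB
    have e3 := c w hw b hbB
    have e4 := no z1 z2 w h11 h12 h21 h22 hw e1
    have t1 := h.cov {w, b, z1, z2} (star_CB H w b z1 z2 e1 e2 e3 n1 n2 e4) w z1 z1 (by simp) (by simp) e1.symm (by simp [hw]) (by simp) (by simp [h11, h12])
    rcases t1 with t1 | t1
    · have zP : z2 ∈ P := t1 (by simp)
      have := h.cP u0 uP b bP z2 zP (c u0 hu0 b hbB)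
      grind
    · have zQ : z1 ∈ Q := t1 (by simp)
      have := h.cQ x xQ b bQ z1 zQ (c x hx b hbB)
      have := d1.2.2 x hx
      grind
  have := card_le_six (fun s => s ∈ B1 ∧ s ∈ P ∧ s ∉ Q) (fun s => s ∈ B1 ∧ s ∉ P ∧ s ∉ Q)
    (fun s => s ∈ B1 ∧ s ∈ Q) (fun s => s = b)
    (fun s => (s ∉ B1 ∧ s ∉ B2 ∧ ∃ v ∈ B1, H.Adj s v) ∧ Dd H B1 B2 s P)
    (fun s => (s ∉ B1 ∧ s ∉ B2 ∧ ∃ v ∈ B1, H.Adj s v) ∧ Dd H B1 B2 s Q)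
    (by
      intro s
      rcases all s with a | a | a
      · by_cases hp : s ∈ P <;> by_cases hq : s ∈ Q <;>
          first
          | exact Or.inl ⟨a, hp, hq⟩
          | exact Or.inr (Or.inl ⟨a, hp, hq⟩)
          | exact Or.inr (Or.inr (Or.inl ⟨a, hq⟩))
      · exact Or.inr (Or.inr (Or.inr (Or.inl a)))
      · obtain ⟨x1, x2, v, hv, hxv⟩ := id a
        rcases caseB_D h ho s v x1 x2 hv hxv with d | d
        · exact Or.inr (Or.inr (Or.inr (Or.inr (Or.inl ⟨a, d⟩))))
        · exact Or.inr (Or.inr (Or.inr (Or.inr (Or.inr ⟨a, d⟩)))))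
    (fun s t a b => E1 s a.1 t b.1 (by simp [a.2, b.2]) (by simp [a.2, b.2]))
    (fun s t a b => E1 s a.1 t b.1 (by simp [a.2, b.2]) (by simp [a.2, b.2]))
    (fun s t a b => E1 s a.1 t b.1
      (by
        have := a.1
        have := b.1
        have := a.2
        have := b.2
        rcases nest with n | n
        · have := n s ‹_› ‹_›
          have := n t ‹_› ‹_›
          first | exact iff_of_false ‹s ∉ P› ‹t ∉ P› | exact iff_of_true ‹s ∈ P› ‹t ∈ P›
        · have := n s ‹_› ‹_›
          have := n t ‹_› ‹_›
          first | exact iff_of_false ‹s ∉ P› ‹t ∉ P› | exact iff_of_true ‹s ∈ P› ‹t ∈ P›) (by simp [a.2, b.2]))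
    (fun s t a b => a.trans b.symm)
    (fun t t' ht ht' => h.tw _ _ fun x =>
      ⟨T2 t t' x ht.1 ht'.1 (fun u hu => (ht.2.2.2 u hu).symm.trans (ht'.2.2.2 u hu)),
       T2 t' t x ht'.1 ht.1 (fun u hu => (ht'.2.2.2 u hu).symm.trans (ht.2.2.2 u hu))⟩)
    (fun t t' ht ht' => h.tw _ _ fun x =>
      ⟨T2 t t' x ht.1 ht'.1 (fun u hu => (ht.2.2.2 u hu).symm.trans (ht'.2.2.2 u hu)),
       T2 t' t x ht'.1 ht.1 (fun u hu => (ht'.2.2.2 u hu).symm.trans (ht.2.2.2 u hu))⟩)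
  omega

theorem caseB_one {V : Type} [Fintype V] {H : SimpleGraph V} {B1 B2 P Q : Set V}
    (h : Sit H B1 B2 P Q) (hcard : 7 ≤ Fintype.card V) (ho : OneSided H B1 B2)
    (hn : ∀ z, z ∉ B1 → z ∉ B2 → ∀ b ∈ B2, ¬ H.Adj z b) : Alt2 H (B1 ∪ B2) := by
  have hs := fun a b => H.adj_comm a b
  have hir := fun v => H.irrefl (v := v)
  have dj := h.dj
  have i1 := h.i1
  have i2 := h.i2
  have c := h.c
  have nbB : ∀ b ∈ B2, ∀ x, H.Adj b x ↔ x ∈ B1 := by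
    intro b hb x
    refine ⟨fun hbx => ?_, fun hx => (c x hx b hb).symm⟩
    by_contra h1
    by_cases h2 : x ∈ B2
    · grind
    · exact hn x h1 h2 b hb hbx.symm
  obtain ⟨b, hbB⟩ := h.ne2
  have hb : ∀ x, x ∈ B2 ↔ x = b := by
    intro x
    refine ⟨fun hx => h.tw _ _ fun y => ?_, fun hx => hx ▸ hbB⟩
    rw [nbB x hx, nbB b hbB]
  by_cases hz : ∃ z, z ∉ B1 ∧ z ∉ B2 ∧ ∃ v ∈ B1, H.Adj z v
  swap
  · exfalso
    obtain ⟨v0, hv0⟩ := h.ne1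
    have nz : ∀ x s, x ∈ B1 → H.Adj x s → s ∈ B2 := by
      intro x s hx hxs
      by_contra h2
      by_cases h1 : s ∈ B1
      · grind
      · exact hz ⟨s, h1, h2, x, hx, hxs.symm⟩
    have all : ∀ s, s ∈ B1 ∨ s ∈ B2 := by
      refine closed_univ H h.conn (fun s => s ∈ B1 ∨ s ∈ B2) v0 (Or.inl hv0) ?_
      intro x s hx hxs
      rcases hx with hx | hx
      · exact Or.inr (nz x s hx hxs)
      · exact Or.inl ((nbB x hx s).1 hxs)
    have e : ∀ u ∈ B1, ∀ u' ∈ B1, u = u' := fun u hu u' hu' => h.tw _ _ fun x =>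
      ⟨fun hh => c u' hu' x (nz u x hu hh), fun hh => c u hu x (nz u' x hu' hh)⟩
    have := card_le_six (fun s => s ∈ B1) (fun s => s = b) (fun _ => False) (fun _ => False)
      (fun _ => False) (fun _ => False) (by
        intro s
        have := all s
        have := hb s
        tauto) (fun s t a b => e s a t b) (by grind) (by simp) (by simp) (by simp) (by simp)
    omega
  by_cases same : ∀ t t', t ∉ B1 → t ∉ B2 → t' ∉ B1 → t' ∉ B2 → (∃ v ∈ B1, H.Adj t v) →
      (∃ v ∈ B1, H.Adj t' v) → ∀ u ∈ B1, H.Adj t u → H.Adj t' u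
  · obtain ⟨z, z1, z2, w, hw, hzw⟩ := hz
    have nz : ∃ a ∈ B1, ¬ H.Adj z a := by
      by_contra! hh
      exact h.mx z z1 z2 ⟨hh, hn z z1 z2⟩
    obtain ⟨a, ha, hza⟩ := nz
    have tr : ∀ x, x ∉ B1 → x ∉ B2 → ∀ u ∈ B1, H.Adj x u → ∀ u' ∈ B1,
        (H.Adj x u' ↔ H.Adj z u') := by
      intro x x1 x2 u hu hxu u' hu'
      exact ⟨same x z x1 x2 z1 z2 ⟨u, hu, hxu⟩ ⟨w, hw, hzw⟩ u' hu',
        same z x z1 z2 x1 x2 ⟨w, hw, hzw⟩ ⟨u, hu, hxu⟩ u' hu'⟩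
    clear same
    have T1 : ∀ u ∈ B1, ∀ u' ∈ B1, (H.Adj z u ↔ H.Adj z u') → ∀ x, H.Adj u x → H.Adj u' x := by
      intro u hu u' hu' e x hux
      by_cases h1 : x ∈ B1
      · grind
      by_cases h2 : x ∈ B2
      · grind
      have a1 := tr x h1 h2 u hu hux.symm u hu
      have a2 := tr x h1 h2 u hu hux.symm u' hu'
      grind
    have E1 : ∀ u ∈ B1, ∀ u' ∈ B1, (H.Adj z u ↔ H.Adj z u') → u = u' := fun u hu u' hu' e =>
      h.tw _ _ fun x => ⟨T1 u hu u' hu' e x, T1 u' hu' u hu e.symm x⟩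
    have B1e : ∀ x, x ∈ B1 ↔ x = a ∨ x = w := by
      intro x
      constructor
      · intro hx
        by_cases hzx : H.Adj z x
        · exact Or.inr (E1 x hx w hw (by simp [hzx, hzw]))
        · exact Or.inl (E1 x hx a ha (by simp [hzx, hza]))
      · rintro (rfl | rfl) <;> assumption
    have hab := c a ha b hbB
    have hwb := c w hw b hbB
    refine ⟨a, b, w, hab.ne, hwb.ne.symm, ?_, ?_, hab, hwb.symm, i1 a ha w hw, ?_, ?_⟩
    · rintro rfl
      exact hza hzw
    · ext x
      simp only [Set.mem_union, Set.mem_insert_iff, Set.mem_singleton_iff, B1e, hb]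
      tauto
    · ext x
      simp only [Set.mem_singleton_iff, SimpleGraph.mem_neighborSet]
      refine ⟨fun hax => ?_, fun hx => hx ▸ hab⟩
      by_contra hxb
      have h1 : x ∉ B1 := fun h1 => i1 a ha x h1 hax
      have h2 : x ∉ B2 := fun h2 => hxb ((hb x).1 h2)
      exact hza ((tr x h1 h2 a ha hax.symm a ha).1 hax.symm)
    · ext x
      simp only [Set.mem_insert_iff, Set.mem_singleton_iff, SimpleGraph.mem_neighborSet]
      rw [nbB b hbB, B1e]
  · exfalso
    push Not at same
    obtain ⟨z1, z2, h11, h12, h21, h22, ⟨v1, hv1, e1⟩, ⟨v2, hv2, e2⟩, u0, hu0, a1, a2⟩ := same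
    rcases caseB_D h ho z1 v1 h11 h12 hv1 e1 with d | d <;>
      rcases caseB_D h ho z2 v2 h21 h22 hv2 e2 with e | e
    · exact a2 ((e.2.2 u0 hu0).1 ((d.2.2 u0 hu0).2 a1))
    · exact caseB_one_aux h hcard ho hn b hb z1 z2 u0 h11 h12 h21 h22 hu0 a1 a2 d e
    · exact caseB_one_aux h.swapP hcard ho hn b hb z1 z2 u0 h11 h12 h21 h22 hu0 a1 a2 d e
    · exact a2 ((e.2.2 u0 hu0).1 ((d.2.2 u0 hu0).2 a1))

theorem main_alt {V : Type} [Fintype V] {H : SimpleGraph V} {B1 B2 P Q : Set V}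
    (h : Sit H B1 B2 P Q) (hcard : 7 ≤ Fintype.card V) :
    Alt1 H (B1 ∪ B2) ∨ Alt2 H (B1 ∪ B2) := by
  by_cases ho : OneSided H B1 B2
  · right
    have ho' : OneSided H B2 B1 := fun z a b c d e f g i => ho z b a e f c d i g
    by_cases hn : ∀ z, z ∉ B1 → z ∉ B2 → ∀ b ∈ B2, ¬ H.Adj z b
    · exact caseB_one h hcard ho hn
    · by_cases hn' : ∀ z, z ∉ B2 → z ∉ B1 → ∀ b ∈ B1, ¬ H.Adj z b
      · rw [Set.union_comm]
        exact caseB_one h.swapB hcard ho' hn'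
      · push Not at hn hn'
        obtain ⟨z2, h21, h22, v2, hv2, a2⟩ := hn
        obtain ⟨z1, h12, h11, v1, hv1, a1⟩ := hn'
        exact (caseB_two h hcard ho z1 v1 z2 v2 h11 h12 h21 h22 hv1 hv2 a1 a2).elim
  · left
    unfold OneSided at ho
    push Not at ho
    obtain ⟨z, h1, h2, a, ha, b, hb, hza, hzb⟩ := ho
    exact caseA h hcard z a b h1 h2 ha hb hza hzb

theorem mk_sit {V : Type} [Fintype V] (H : SimpleGraph V) (hconn : H.Connected)
    (htwinfree : ∀ v w : V, v ≠ w → H.neighborSet v ≠ H.neighborSet w)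
    (B : Set V) (hB : IsBiclique H B)
    (hdeg : {S : Set V | IsBiclique H S ∧ S ≠ B ∧ (S ∩ B).Nonempty}.ncard = 2) :
    ∃ B1 B2 P Q, B1 ∪ B2 = B ∧ Sit H B1 B2 P Q := by
  obtain ⟨P, Q, -, hPQ⟩ := Set.ncard_eq_two.1 hdeg
  have hP : P ∈ {S : Set V | IsBiclique H S ∧ S ≠ B ∧ (S ∩ B).Nonempty} := by simp [hPQ]
  have hQ : Q ∈ {S : Set V | IsBiclique H S ∧ S ≠ B ∧ (S ∩ B).Nonempty} := by simp [hPQ]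
  have hall : ∀ S, IsBiclique H S → S ≠ B → (S ∩ B).Nonempty → S = P ∨ S = Q := by
    intro S h1 h2 h3
    have : S ∈ {S : Set V | IsBiclique H S ∧ S ≠ B ∧ (S ∩ B).Nonempty} := ⟨h1, h2, h3⟩
    rw [hPQ] at this
    simpa using this
  obtain ⟨⟨B1, B2, ⟨n1, n2, dj, i1, i2, c⟩, rfl⟩, hmax⟩ := id hB
  have maxz : ∀ z, z ∉ B1 → z ∉ B2 → ∀ C1 C2, IsCBP H C1 C2 →
      C1 ∪ C2 = insert z (B1 ∪ B2) → False := by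
    intro z h1 h2 C1 C2 hC e
    have := hmax (insert z (B1 ∪ B2)) ⟨C1, C2, hC, e⟩ (Set.subset_insert _ _)
    have hz : z ∈ B1 ∪ B2 := by
      rw [this]
      exact Set.mem_insert _ _
    exact hz.elim h1 h2
  have hs := fun a b => H.adj_comm a b
  have hir := fun v => H.irrefl (v := v)
  refine ⟨B1, B2, P, Q, rfl, ?_⟩
  refine ⟨hconn, ?_, n1, n2, fun x hx hx' => Set.disjoint_left.1 dj hx hx', i1, i2, c, ?_, ?_,
    ((cbs_iff H P).1 hP.1.1).2, ((cbs_iff H Q).1 hQ.1.1).2, ?_, ?_, ?_⟩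
  · intro v w hvw
    by_contra hne
    exact htwinfree v w hne (Set.ext hvw)
  · rintro z h1 h2 ⟨h3, h4⟩
    refine maxz z h1 h2 B1 (insert z B2) ⟨n1, Set.insert_nonempty _ _, ?_, i1, ?_, ?_⟩
      (Set.union_insert ..)
    · rw [Set.disjoint_insert_right]
      exact ⟨h1, dj⟩
    · simp only [Set.mem_insert_iff]
      grind
    · simp only [Set.mem_insert_iff]
      grind
  · rintro z h1 h2 ⟨h3, h4⟩
    refine maxz z h1 h2 (insert z B1) B2 ⟨Set.insert_nonempty _ _, n2, ?_, ?_, i2, ?_⟩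
      (Set.insert_union ..)
    · rw [Set.disjoint_insert_left]
      exact ⟨h2, dj⟩
    · simp only [Set.mem_insert_iff]
      grind
    · simp only [Set.mem_insert_iff]
      grind
  · intro hh
    exact hP.2.1 (hmax P hP.1.1 hh).symm
  · intro hh
    exact hQ.2.1 (hmax Q hQ.1.1 hh).symm
  · intro T hT x y z hx hy hxy hxB hz hzB
    obtain ⟨S, hS, hTS⟩ := exists_biclique H T ((cbs_iff H T).2 ⟨⟨x, hx, y, hy, hxy⟩, hT⟩)
    rcases hall S hS (fun e => hzB (e ▸ hTS hz)) ⟨x, hTS hx, hxB⟩ with rfl | rfl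
    · exact Or.inl hTS
    · exact Or.inr hTS


/-- Lemma 2: structure of bicliques of degree 2 in the biclique graph. -/
theorem stmt_3 {V : Type} [Fintype V] (H : SimpleGraph V) (hconn : H.Connected)
    (htwinfree : ∀ v w : V, v ≠ w → H.neighborSet v ≠ H.neighborSet w)
    (hcard : 7 ≤ Fintype.card V)
    (B : Set V) (hB : IsBiclique H B)
    (hdeg : {S : Set V | IsBiclique H S ∧ S ≠ B ∧ (S ∩ B).Nonempty}.ncard = 2) :
    Xor'
      (∃ v w x : V, v ≠ w ∧ B = {v, w} ∧ H.Adj v w ∧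
        insert v (H.neighborSet v) = insert w (H.neighborSet w) ∧
        H.neighborSet v ∩ H.neighborSet w = {x} ∧
        ∀ a ∈ H.neighborSet x \ {v, w}, ∀ b ∈ H.neighborSet x \ {v, w}, ¬H.Adj a b)
      (∃ a b c : V, a ≠ b ∧ b ≠ c ∧ a ≠ c ∧ B = {a, b, c} ∧
        H.Adj a b ∧ H.Adj b c ∧ ¬H.Adj a c ∧
        H.neighborSet a = {b} ∧ H.neighborSet b = {a, c}) := by
  obtain ⟨B1, B2, P, Q, rfl, hsit⟩ := mk_sit H hconn htwinfree B hB hdeg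
  have key := main_alt hsit hcard
  have excl : Alt1 H (B1 ∪ B2) → Alt2 H (B1 ∪ B2) → False := by
    rintro ⟨v, w, x, hvw, e1, -⟩ ⟨a, b, c, hab, hbc, hac, e2, -⟩
    rw [e1] at e2
    have ha : a ∈ ({v, w} : Set V) := by simp [e2]
    have hb : b ∈ ({v, w} : Set V) := by simp [e2]
    have hc : c ∈ ({v, w} : Set V) := by simp [e2]
    simp only [Set.mem_insert_iff, Set.mem_singleton_iff] at ha hb hc
    grind
  rcases key with k | k
  · exact Or.inl ⟨k, fun k' => excl k k'⟩
  · exact Or.inr ⟨k, fun k' => excl k' k⟩
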